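/- arXiv:2209.15037 — 2 statements merged into one kernel-verified Lean document; each statement's English description precedes it below -/
import Mathlib

section
/- Assume there is no strict ε-arbitrage. Then for every t = 1,…,T the set E_{ε,t} is a convex cone: if H¹_t, H²_t ∈ E_{ε,t} and c > 0 is a real constant, then c·H¹_t ∈ E_{ε,t} and H¹_t + H²_t ∈ E_{ε,t}. -/
open MeasureTheory Filter
open scoped ENNReal NNReal

noncomputable section

namespace QFTAP

/-- The `p`-norm on `ℝ^d`. -/
def pNorm {d : ℕ} (p : ℝ) (x : Fin d → ℝ) : ℝ := (∑ i, |x i| ^ p) ^ (1 / p)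

/-- The norm dual to the `p`-norm, i.e. the `q`-norm where `1/p + 1/q = 1`
(`q = ∞` when `p = 1`, and `q = p/(p-1)` when `p > 1`). -/
def qNorm {d : ℕ} (p : ℝ) (x : Fin d → ℝ) : ℝ :=
  if p = 1 then ⨆ i, |x i| else pNorm (p / (p - 1)) x

/-- Euclidean scalar product on `ℝ^d`. -/
def dot {d : ℕ} (x y : Fin d → ℝ) : ℝ := ∑ i, x i * y i

/-- The dual vector `x*` (with the convention `0* = 0`): `x*_i = sgn(x_i) |x_i|^{p-1} / |x|_p^{p-1}`. -/
def dualVec {d : ℕ} (p : ℝ) (x : Fin d → ℝ) : Fin d → ℝ :=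
  fun i => Real.sign (x i) * |x i| ^ (p - 1) / (pNorm p x) ^ (p - 1)

variable {Ω : Type*} [mΩ : MeasurableSpace Ω] {d : ℕ}

/-- A trading strategy: `H t` is `ℱ (t-1)`-measurable for every `t ≥ 1`. -/
def IsStrategy (ℱ : Filtration ℕ mΩ) (H : ℕ → Ω → Fin d → ℝ) : Prop :=
  ∀ t : ℕ, 1 ≤ t → StronglyMeasurable[ℱ (t - 1)] (H t)

/-- The terminal gain `(H • S)_T = ∑_{t=1}^T H_t · ΔS_t`. -/
def gain (S H : ℕ → Ω → Fin d → ℝ) (T : ℕ) (ω : Ω) : ℝ :=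
  ∑ t ∈ Finset.Icc 1 T, dot (H t ω) (S t ω - S (t - 1) ω)

/-- `‖H‖_p = ∑_{t=1}^T |H_t|_p`. -/
def stratNorm (p : ℝ) (H : ℕ → Ω → Fin d → ℝ) (T : ℕ) (ω : Ω) : ℝ :=
  ∑ t ∈ Finset.Icc 1 T, pNorm p (H t ω)

/-- `H` is a strict `ε`-arbitrage. -/
def IsStrictArb (P : Measure Ω) (ℱ : Filtration ℕ mΩ) (S : ℕ → Ω → Fin d → ℝ) (T : ℕ)
    (p ε : ℝ) (H : ℕ → Ω → Fin d → ℝ) : Prop :=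
  IsStrategy ℱ H ∧
    (∀ᵐ ω ∂P, 0 ≤ gain S H T ω - ε * stratNorm p H T ω) ∧
    0 < P {ω | 0 < gain S H T ω - ε * stratNorm p H T ω}

/-- A sequence of trading strategies is an `ε`-arbitrage. -/
def IsArb (P : Measure Ω) (ℱ : Filtration ℕ mΩ) (S : ℕ → Ω → Fin d → ℝ) (T : ℕ)
    (p ε : ℝ) (H : ℕ → ℕ → Ω → Fin d → ℝ) : Prop :=
  (∀ k, IsStrategy ℱ (H k)) ∧
    (∀ᵐ ω ∂P, 0 ≤ atTop.liminf fun k => gain S (H k) T ω - ε * stratNorm p (H k) T ω) ∧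
    0 < P {ω | 0 < atTop.liminf fun k => gain S (H k) T ω - ε * stratNorm p (H k) T ω}

/-- The market satisfies `NA_ε`: there is no `ε`-arbitrage. -/
def NA (P : Measure Ω) (ℱ : Filtration ℕ mΩ) (S : ℕ → Ω → Fin d → ℝ) (T : ℕ) (p ε : ℝ) : Prop :=
  ¬ ∃ H, IsArb P ℱ S T p ε H

/-- The critical value `ε(P) = inf {ε > 0 : no strict ε-arbitrage}`, with `inf ∅ = ∞`. -/
def criticalValue (P : Measure Ω) (ℱ : Filtration ℕ mΩ) (S : ℕ → Ω → Fin d → ℝ) (T : ℕ)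
    (p : ℝ) : ℝ≥0∞ :=
  sInf {x : ℝ≥0∞ | ∃ ε : ℝ, 0 < ε ∧ (¬ ∃ H, IsStrictArb P ℱ S T p ε H) ∧ x = ENNReal.ofReal ε}

/-- `Q` is an `ε`-martingale measure: `Q` is a probability measure equivalent to `P`,
`S_T ∈ L¹(Q)` and `|E_Q[S_t | ℱ_{t-1}] - S_{t-1}|_q ≤ ε` a.s. for all `t = 1,…,T`. -/
def IsEpsMartMeasure (P : Measure Ω) (ℱ : Filtration ℕ mΩ) (S : ℕ → Ω → Fin d → ℝ) (T : ℕ)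
    (p ε : ℝ) (Q : Measure Ω) : Prop :=
  IsProbabilityMeasure Q ∧ Q ≪ P ∧ P ≪ Q ∧ Integrable (S T) Q ∧
    ∀ t : ℕ, 1 ≤ t → t ≤ T →
      ∀ᵐ ω ∂Q, qNorm p ((Q[S t | ℱ (t - 1)]) ω - S (t - 1) ω) ≤ ε

/-- `𝓜_ε(P)`: the `ε`-martingale measures with `P`-essentially bounded density `dQ/dP`. -/
def Meps (P : Measure Ω) (ℱ : Filtration ℕ mΩ) (S : ℕ → Ω → Fin d → ℝ) (T : ℕ)
    (p ε : ℝ) : Set (Measure Ω) :=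
  {Q | IsEpsMartMeasure P ℱ S T p ε Q ∧ ∃ C : ℝ≥0, ∀ᵐ ω ∂P, Q.rnDeriv P ω ≤ C}

/-- `K = {(H•S)_T - ε ‖H‖_p : H ∈ 𝓗}`. -/
def Kset (ℱ : Filtration ℕ mΩ) (S : ℕ → Ω → Fin d → ℝ) (T : ℕ) (p ε : ℝ) : Set (Ω → ℝ) :=
  {X | ∃ H, IsStrategy ℱ H ∧ X = fun ω => gain S H T ω - ε * stratNorm p H T ω}

/-- `K̄`: the closure of `K` with respect to convergence in `P`-probability. -/
def Kbar (P : Measure Ω) (ℱ : Filtration ℕ mΩ) (S : ℕ → Ω → Fin d → ℝ) (T : ℕ)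
    (p ε : ℝ) : Set (Ω → ℝ) :=
  {X | ∃ Y : ℕ → Ω → ℝ, (∀ n, Y n ∈ Kset ℱ S T p ε) ∧ TendstoInMeasure P Y atTop X}

/-- `C = {X : ∃ Y ∈ K̄, X ≤ Y a.s.}`. -/
def Cset (P : Measure Ω) (ℱ : Filtration ℕ mΩ) (S : ℕ → Ω → Fin d → ℝ) (T : ℕ)
    (p ε : ℝ) : Set (Ω → ℝ) :=
  {X | ∃ Y ∈ Kbar P ℱ S T p ε, ∀ᵐ ω ∂P, X ω ≤ Y ω}

/-- `E_{ε,t} = {H_t ∈ 𝓗_t : H_t · ΔS_t = ε |H_t|_p a.s.}`. -/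
def Eset (P : Measure Ω) (ℱ : Filtration ℕ mΩ) (S : ℕ → Ω → Fin d → ℝ)
    (p ε : ℝ) (t : ℕ) : Set (Ω → Fin d → ℝ) :=
  {h | StronglyMeasurable[ℱ (t - 1)] h ∧
    ∀ᵐ ω ∂P, dot (h ω) (S t ω - S (t - 1) ω) = ε * pNorm p (h ω)}

/-- `E_{0,t} = {H_t ∈ 𝓗_t : H_t · ΔS_t = 0 a.s.}`. -/
def E0set (P : Measure Ω) (ℱ : Filtration ℕ mΩ) (S : ℕ → Ω → Fin d → ℝ)
    (t : ℕ) : Set (Ω → Fin d → ℝ) :=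
  {h | StronglyMeasurable[ℱ (t - 1)] h ∧
    ∀ᵐ ω ∂P, dot (h ω) (S t ω - S (t - 1) ω) = 0}

/-- `E_{0,t}^⊥`. -/
def E0perp (P : Measure Ω) (ℱ : Filtration ℕ mΩ) (S : ℕ → Ω → Fin d → ℝ)
    (t : ℕ) : Set (Ω → Fin d → ℝ) :=
  {h | StronglyMeasurable[ℱ (t - 1)] h ∧
    ∀ g ∈ E0set P ℱ S t, ∀ᵐ ω ∂P, dot (h ω) (g ω) = 0}

/-- `F_{ε,t} = {X_t ∈ 𝓗_t : X_t · H_t = |X_t|_q |H_t|_p a.s. for every H_t ∈ E_{ε,t}}`. -/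
def Fset (P : Measure Ω) (ℱ : Filtration ℕ mΩ) (S : ℕ → Ω → Fin d → ℝ)
    (p ε : ℝ) (t : ℕ) : Set (Ω → Fin d → ℝ) :=
  {X | StronglyMeasurable[ℱ (t - 1)] X ∧
    ∀ h ∈ Eset P ℱ S p ε t, ∀ᵐ ω ∂P, dot (X ω) (h ω) = qNorm p (X ω) * pNorm p (h ω)}

/-- `F_{ε,t}^⊥`, depending on a fixed maximal element `H̄_t` of `E_{ε,t}` when `p = 1`. -/
def Fperp (P : Measure Ω) (ℱ : Filtration ℕ mΩ) (S : ℕ → Ω → Fin d → ℝ)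
    (p ε : ℝ) (t : ℕ) (Hb : Ω → Fin d → ℝ) : Set (Ω → Fin d → ℝ) :=
  if p = 1 then
    {h | StronglyMeasurable[ℱ (t - 1)] h ∧
      (∀ᵐ ω ∂P, dot (dualVec 1 (Hb ω)) (h ω) = 0) ∧
      ∀ i, ∀ᵐ ω ∂P, Hb ω i = 0 → h ω i = 0}
  else
    {h | StronglyMeasurable[ℱ (t - 1)] h ∧
      ∀ X ∈ Fset P ℱ S p ε t, ∀ᵐ ω ∂P, dot (X ω) (h ω) = 0}

/-- `𝓗̄_t`: strategies supported on the support of `H̄_t` (componentwise when `p = 1`). -/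
def HbarSpace (P : Measure Ω) (ℱ : Filtration ℕ mΩ) (p : ℝ) (t : ℕ)
    (Hb : Ω → Fin d → ℝ) : Set (Ω → Fin d → ℝ) :=
  if p = 1 then
    {h | StronglyMeasurable[ℱ (t - 1)] h ∧ ∀ i, ∀ᵐ ω ∂P, Hb ω i = 0 → h ω i = 0}
  else
    {h | StronglyMeasurable[ℱ (t - 1)] h ∧ ∀ᵐ ω ∂P, Hb ω = 0 → h ω = 0}

/-- The defining properties of `H̄_t`: an element of `E_{ε,t}` with `|H̄_t|_p ∈ {0,1}` a.s. of
maximal support (componentwise maximal when `p = 1`). -/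
def IsMaximalEps (P : Measure Ω) (ℱ : Filtration ℕ mΩ) (S : ℕ → Ω → Fin d → ℝ)
    (p ε : ℝ) (t : ℕ) (Hb : Ω → Fin d → ℝ) : Prop :=
  Hb ∈ Eset P ℱ S p ε t ∧
    (∀ᵐ ω ∂P, pNorm p (Hb ω) = 0 ∨ pNorm p (Hb ω) = 1) ∧
    (1 < p → P {ω | Hb ω ≠ 0} = ⨆ h ∈ Eset P ℱ S p ε t, P {ω | h ω ≠ 0}) ∧
    (p = 1 → ∀ i, P {ω | Hb ω i ≠ 0} = ⨆ h ∈ Eset P ℱ S p ε t, P {ω | h ω i ≠ 0})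

/-- `F_ε^⊥ = {G ∈ 𝓗 : G_t ∈ F_{ε,t}^⊥ for every t = 1,…,T}`. -/
def FperpStrat (P : Measure Ω) (ℱ : Filtration ℕ mΩ) (S : ℕ → Ω → Fin d → ℝ) (T : ℕ)
    (p ε : ℝ) (Hb : ℕ → Ω → Fin d → ℝ) : Set (ℕ → Ω → Fin d → ℝ) :=
  {G | ∀ t, 1 ≤ t → t ≤ T → G t ∈ Fperp P ℱ S p ε t (Hb t)}

/-- The market satisfies `NA'_ε`. -/
def NAprime (P : Measure Ω) (ℱ : Filtration ℕ mΩ) (S : ℕ → Ω → Fin d → ℝ) (T : ℕ)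
    (p ε : ℝ) (Hb : ℕ → Ω → Fin d → ℝ) : Prop :=
  (¬ ∃ H, IsStrictArb P ℱ S T p ε H) ∧
    ∀ G ∈ FperpStrat P ℱ S T p ε Hb,
      (∀ᵐ ω ∂P, 0 ≤ gain S G T ω) → ∀ᵐ ω ∂P, gain S G T ω = 0

/-- `ψ` is an `ε`-fair price for `Ψ`. -/
def IsFairPrice (P : Measure Ω) (ℱ : Filtration ℕ mΩ) (S : ℕ → Ω → Fin d → ℝ) (T : ℕ)
    (p ε : ℝ) (Ψ : Ω → ℝ) (ψ : ℝ) : Prop :=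
  ∀ (H : ℕ → ℕ → Ω → Fin d → ℝ) (a : ℕ → ℝ), (∀ k, IsStrategy ℱ (H k)) →
    (∀ᵐ ω ∂P, 0 ≤ atTop.liminf fun k =>
      gain S (H k) T ω + a k * (Ψ ω - ψ) - ε * (stratNorm p (H k) T ω + |a k|)) →
    ∀ᵐ ω ∂P, atTop.liminf (fun k =>
      gain S (H k) T ω + a k * (Ψ ω - ψ) - ε * (stratNorm p (H k) T ω + |a k|)) = 0



theorem pNorm_zero {p : ℝ} (hp : 1 ≤ p) : pNorm p (0 : Fin d → ℝ) = 0 := by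
  have hp0 : p ≠ 0 := by positivity
  simp [pNorm, Real.zero_rpow hp0, Real.zero_rpow (inv_ne_zero hp0)]

theorem pNorm_smul_of_nonneg {p : ℝ} (hp : 1 ≤ p) {c : ℝ} (hc : 0 ≤ c) (x : Fin d → ℝ) :
    pNorm p (c • x) = c * pNorm p x := by
  have hp0 : p ≠ 0 := by positivity
  have hsum : 0 ≤ ∑ i, |x i| ^ p :=
    Finset.sum_nonneg fun i _ => Real.rpow_nonneg (abs_nonneg _) _
  simp only [pNorm, Pi.smul_apply, smul_eq_mul, abs_mul, abs_of_nonneg hc,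
    Real.mul_rpow hc (abs_nonneg _), ← Finset.mul_sum]
  rw [Real.mul_rpow (Real.rpow_nonneg hc p) hsum, one_div, Real.rpow_rpow_inv hc hp0]

theorem pNorm_add_le {p : ℝ} (hp : 1 ≤ p) (x y : Fin d → ℝ) :
    pNorm p (x + y) ≤ pNorm p x + pNorm p y :=
  Real.Lp_add_le Finset.univ x y hp

theorem zero_dot (y : Fin d → ℝ) : dot 0 y = 0 := by
  simp [dot]

theorem smul_dot (c : ℝ) (x y : Fin d → ℝ) : dot (c • x) y = c * dot x y := by
  simp [dot, Finset.mul_sum, mul_assoc]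

theorem add_dot (x y z : Fin d → ℝ) : dot (x + y) z = dot x z + dot y z := by
  simp [dot, add_mul, Finset.sum_add_distrib]

/-- The strategy that invests `h` at time `t` and nothing at all other times. -/
def singlePeriod (t : ℕ) (h : Ω → Fin d → ℝ) : ℕ → Ω → Fin d → ℝ :=
  Pi.single t h

theorem isStrategy_singlePeriod {ℱ : Filtration ℕ mΩ} {t : ℕ} {h : Ω → Fin d → ℝ}
    (hh : StronglyMeasurable[ℱ (t - 1)] h) : IsStrategy ℱ (singlePeriod t h) := by
  intro s _
  obtain rfl | hst := eq_or_ne s t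
  · simpa [singlePeriod] using hh
  · rw [singlePeriod, Pi.single_eq_of_ne hst]
    exact stronglyMeasurable_zero

theorem gain_singlePeriod (S : ℕ → Ω → Fin d → ℝ) {t T : ℕ} (ht1 : 1 ≤ t) (htT : t ≤ T)
    (h : Ω → Fin d → ℝ) (ω : Ω) :
    gain S (singlePeriod t h) T ω = dot (h ω) (S t ω - S (t - 1) ω) := by
  rw [gain, Finset.sum_eq_single_of_mem t (Finset.mem_Icc.2 ⟨ht1, htT⟩)]
  · simp [singlePeriod]
  · intro s _ hst
    simp [singlePeriod, Pi.single_eq_of_ne hst, zero_dot]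

theorem stratNorm_singlePeriod {p : ℝ} (hp : 1 ≤ p) {t T : ℕ} (ht1 : 1 ≤ t) (htT : t ≤ T)
    (h : Ω → Fin d → ℝ) (ω : Ω) :
    stratNorm p (singlePeriod t h) T ω = pNorm p (h ω) := by
  rw [stratNorm, Finset.sum_eq_single_of_mem t (Finset.mem_Icc.2 ⟨ht1, htT⟩)]
  · simp [singlePeriod]
  · intro s _ hst
    simp [singlePeriod, Pi.single_eq_of_ne hst, pNorm_zero hp]

/-- Without strict `ε`-arbitrage, a one-period position whose gain covers its cost almost surely
gains exactly its cost. -/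
theorem mem_Eset_of_ae_le {P : Measure Ω} {ℱ : Filtration ℕ mΩ} {S : ℕ → Ω → Fin d → ℝ}
    {T : ℕ} {p ε : ℝ} (hp : 1 ≤ p) (hNSA : ¬ ∃ H, IsStrictArb P ℱ S T p ε H)
    {t : ℕ} (ht1 : 1 ≤ t) (htT : t ≤ T) {h : Ω → Fin d → ℝ}
    (hh : StronglyMeasurable[ℱ (t - 1)] h)
    (hle : ∀ᵐ ω ∂P, ε * pNorm p (h ω) ≤ dot (h ω) (S t ω - S (t - 1) ω)) :
    h ∈ Eset P ℱ S p ε t := by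
  have hnull : P {ω | 0 < dot (h ω) (S t ω - S (t - 1) ω) - ε * pNorm p (h ω)} = 0 := by
    by_contra hpos
    refine hNSA ⟨singlePeriod t h, isStrategy_singlePeriod hh, ?_, ?_⟩
    · filter_upwards [hle] with ω hω
      rw [gain_singlePeriod S ht1 htT, stratNorm_singlePeriod hp ht1 htT]
      exact sub_nonneg.2 hω
    · simpa only [gain_singlePeriod S ht1 htT, stratNorm_singlePeriod hp ht1 htT]
        using pos_iff_ne_zero.2 hpos
  refine ⟨hh, ?_⟩
  filter_upwards [hle, measure_eq_zero_iff_ae_notMem.1 hnull] with ω hω hω'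
  exact le_antisymm (sub_nonpos.1 (not_lt.1 hω')) hω

/-- Under the absence of strict `ε`-arbitrage, each `E_{ε,t}` is a convex cone:
closed under multiplication by positive constants and under addition. -/
theorem Eset_convex_cone
    {Ω : Type*} [mΩ : MeasurableSpace Ω] {d T : ℕ}
    (P : Measure Ω) [IsProbabilityMeasure P] (ℱ : Filtration ℕ mΩ)
    (S : ℕ → Ω → Fin d → ℝ) (hS : Adapted ℱ S)
    (hd : 1 ≤ d) (hT : 1 ≤ T) (p ε : ℝ) (hp : 1 ≤ p) (hε : 0 < ε)
    (hNSA : ¬ ∃ H, IsStrictArb P ℱ S T p ε H)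
    (t : ℕ) (ht1 : 1 ≤ t) (htT : t ≤ T) :
    (∀ h ∈ Eset P ℱ S p ε t, ∀ c : ℝ, 0 < c → (fun ω => c • h ω) ∈ Eset P ℱ S p ε t) ∧
    (∀ h₁ ∈ Eset P ℱ S p ε t, ∀ h₂ ∈ Eset P ℱ S p ε t, h₁ + h₂ ∈ Eset P ℱ S p ε t) := by
  refine ⟨fun h hh c hc => ⟨hh.1.const_smul c, ?_⟩, fun h₁ hh₁ h₂ hh₂ => ?_⟩
  · filter_upwards [hh.2] with ω hω
    rw [smul_dot, pNorm_smul_of_nonneg hp hc.le, hω]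
    ring
  · refine mem_Eset_of_ae_le hp hNSA ht1 htT (hh₁.1.add hh₂.1) ?_
    filter_upwards [hh₁.2, hh₂.2] with ω hω₁ hω₂
    rw [Pi.add_apply, add_dot, hω₁, hω₂, ← mul_add]
    exact mul_le_mul_of_nonneg_left (pNorm_add_le hp _ _) hε.le

end QFTAP
end
end

section
/- Let Q be an ε-martingale measure and t ∈ {1,…,T}. Then the conditional expectation E_Q[ΔS_t | 𝓕_{t-1}] belongs to F_{ε,t}, and H_t · E_Q[ΔS_t | 𝓕_{t-1}] = 0 P-a.s. for every H_t ∈ F_{ε,t}^⊥. -/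
open MeasureTheory Filter
open scoped ENNReal NNReal

noncomputable section

namespace QFTAP

variable {Ω : Type*} [mΩ : MeasurableSpace Ω] {d : ℕ}

theorem pNorm_nonneg {d : ℕ} (p : ℝ) (x : Fin d → ℝ) : 0 ≤ pNorm p x :=
  Real.rpow_nonneg (Finset.sum_nonneg fun i _ => Real.rpow_nonneg (abs_nonneg (x i)) p) _

theorem abs_le_pNorm {d : ℕ} {p : ℝ} (hp : 0 < p) (x : Fin d → ℝ) (i : Fin d) :
    |x i| ≤ pNorm p x := by
  have h : |x i| ^ p ≤ ∑ j, |x j| ^ p :=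
    Finset.single_le_sum (f := fun j => |x j| ^ p)
      (fun j _ => Real.rpow_nonneg (abs_nonneg (x j)) p) (Finset.mem_univ i)
  calc |x i| = (|x i| ^ p) ^ (1 / p) := by
        rw [one_div, Real.rpow_rpow_inv (abs_nonneg _) hp.ne']
    _ ≤ pNorm p x :=
        Real.rpow_le_rpow (Real.rpow_nonneg (abs_nonneg _) p) h (by positivity)

theorem pNorm_one {d : ℕ} (x : Fin d → ℝ) : pNorm 1 x = ∑ i, |x i| := by
  simp [pNorm]

theorem measurable_pNorm {d : ℕ} (p : ℝ) : Measurable (pNorm p : (Fin d → ℝ) → ℝ) := by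
  unfold pNorm
  fun_prop

theorem abs_le_qNorm {d : ℕ} {p : ℝ} (hp : 1 ≤ p) (x : Fin d → ℝ) (i : Fin d) :
    |x i| ≤ qNorm p x := by
  unfold qNorm
  split_ifs with h
  · exact le_ciSup (f := fun i => |x i|) (Set.finite_range _).bddAbove i
  · have hp' : 1 < p := lt_of_le_of_ne hp (Ne.symm h)
    exact abs_le_pNorm (div_pos (by linarith) (by linarith)) x i

theorem dot_comm {d : ℕ} (x y : Fin d → ℝ) : dot x y = dot y x :=
  Finset.sum_congr rfl fun i _ => mul_comm (x i) (y i)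

theorem dot_smul_left {d : ℕ} (c : ℝ) (x y : Fin d → ℝ) : dot (c • x) y = c * dot x y := by
  simp [dot, Finset.mul_sum, mul_assoc]

/-- Hölder's inequality for the dual pair of the `q`-norm and the `p`-norm. -/
theorem dot_le_qNorm_mul_pNorm {d : ℕ} {p : ℝ} (hp : 1 ≤ p) (x y : Fin d → ℝ) :
    dot x y ≤ qNorm p x * pNorm p y := by
  rcases hp.eq_or_lt with rfl | hp'
  · rw [pNorm_one, Finset.mul_sum]
    refine Finset.sum_le_sum fun i _ => (le_abs_self _).trans ?_
    rw [abs_mul]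
    exact mul_le_mul_of_nonneg_right (abs_le_qNorm le_rfl x i) (abs_nonneg _)
  · rw [qNorm, if_neg hp'.ne']
    exact Real.inner_le_Lp_mul_Lq Finset.univ x y (Real.HolderConjugate.conjExponent hp').symm

/-- The scalar product as a continuous bilinear map. -/
def dotCLM (d : ℕ) : (Fin d → ℝ) →L[ℝ] (Fin d → ℝ) →L[ℝ] ℝ :=
  ∑ i, (ContinuousLinearMap.mul ℝ ℝ).bilinearComp
    (ContinuousLinearMap.proj i) (ContinuousLinearMap.proj i)

theorem dotCLM_apply {d : ℕ} (x y : Fin d → ℝ) : dotCLM d x y = dot x y := by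
  simp [dotCLM, dot]

theorem norm_le_of_qNorm_le {d : ℕ} {p c : ℝ} (hp : 1 ≤ p) (hc : 0 ≤ c) {x : Fin d → ℝ}
    (hx : qNorm p x ≤ c) : ‖x‖ ≤ c :=
  (pi_norm_le_iff_of_nonneg hc).2 fun i => (abs_le_qNorm hp x i).trans hx

/-- Equality in Hölder's inequality for `p = 1` aligns `x` with the signs of `y`. -/
theorem eq_qNorm_mul_sign_of_dot_eq {d : ℕ} {x y : Fin d → ℝ}
    (h : dot x y = qNorm 1 x * pNorm 1 y) {i : Fin d} (hi : y i ≠ 0) :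
    x i = qNorm 1 x * Real.sign (y i) := by
  rw [pNorm_one, Finset.mul_sum] at h
  have hle : ∀ j ∈ Finset.univ, x j * y j ≤ qNorm 1 x * |y j| := fun j _ => by
    refine (le_abs_self _).trans ?_
    rw [abs_mul]
    exact mul_le_mul_of_nonneg_right (abs_le_qNorm le_rfl x j) (abs_nonneg _)
  have heq := (Finset.sum_eq_sum_iff_of_le hle).1 h i (Finset.mem_univ i)
  rcases hi.lt_or_gt with hneg | hpos
  · rw [abs_of_neg hneg] at heq
    rw [Real.sign_of_neg hneg]
    exact mul_right_cancel₀ hi (by linarith)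
  · rw [abs_of_pos hpos] at heq
    rw [Real.sign_of_pos hpos]
    exact mul_right_cancel₀ hi (by linarith)

theorem dualVec_one {d : ℕ} (y : Fin d → ℝ) (i : Fin d) : dualVec 1 y i = Real.sign (y i) := by
  simp [dualVec]

theorem dot_eq_zero_of_dot_dualVec_eq_zero {d : ℕ} {x y z : Fin d → ℝ}
    (h : dot x y = qNorm 1 x * pNorm 1 y) (hz : dot (dualVec 1 y) z = 0)
    (hyz : ∀ i, y i = 0 → z i = 0) : dot z x = 0 := by
  have hsum : dot z x = qNorm 1 x * dot (dualVec 1 y) z := by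
    rw [dot, dot, Finset.mul_sum]
    refine Finset.sum_congr rfl fun i _ => ?_
    by_cases hi : y i = 0
    · simp [hyz i hi]
    · rw [dualVec_one]
      nth_rewrite 1 [eq_qNorm_mul_sign_of_dot_eq h hi]
      ring
  rw [hsum, hz, mul_zero]

theorem IsEpsMartMeasure.integrable {P Q : Measure Ω} {ℱ : Filtration ℕ mΩ}
    {S : ℕ → Ω → Fin d → ℝ} {T : ℕ} {p ε : ℝ} (hQ : IsEpsMartMeasure P ℱ S T p ε Q)
    (hS : Adapted ℱ S) (hp : 1 ≤ p) (hε : 0 ≤ ε) {t : ℕ} (ht : t ≤ T) :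
    Integrable (S t) Q := by
  obtain ⟨hprob, -, -, hST, hbound⟩ := hQ
  induction ht using Nat.decreasingInduction with
  | self => exact hST
  | of_succ k hk ih =>
    have hmeas : AEStronglyMeasurable (S k) Q :=
      ((hS k).mono (ℱ.le k) le_rfl).aestronglyMeasurable
    have hdiff : Integrable (fun ω => (Q[S (k + 1) | ℱ k]) ω - S k ω) Q := by
      refine Integrable.of_bound (integrable_condExp.aestronglyMeasurable.sub hmeas) ε ?_
      filter_upwards [hbound (k + 1) (by omega) hk] with ω hω
      exact norm_le_of_qNorm_le hp hε hω
    refine ((integrable_condExp (m := ℱ k) (f := S (k + 1))).sub hdiff).congr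
      (Eventually.of_forall fun ω => ?_)
    simp

theorem IsEpsMartMeasure.qNorm_condExp_sub_le {P Q : Measure Ω} {ℱ : Filtration ℕ mΩ}
    {S : ℕ → Ω → Fin d → ℝ} {T : ℕ} {p ε : ℝ} (hQ : IsEpsMartMeasure P ℱ S T p ε Q)
    (hS : Adapted ℱ S) (hp : 1 ≤ p) (hε : 0 ≤ ε) {t : ℕ} (ht1 : 1 ≤ t) (htT : t ≤ T) :
    ∀ᵐ ω ∂Q, qNorm p ((Q[fun ω => S t ω - S (t - 1) ω | ℱ (t - 1)]) ω) ≤ ε := by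
  have := hQ.1
  have hprev : Integrable (S (t - 1)) Q := hQ.integrable hS hp hε (by omega)
  have hsub := condExp_sub (hQ.integrable hS hp hε htT) hprev (ℱ (t - 1))
  rw [condExp_of_stronglyMeasurable (ℱ.le _) (hS (t - 1)).stronglyMeasurable hprev] at hsub
  filter_upwards [hsub, hQ.2.2.2.2 t ht1 htT] with ω h1 h2
  exact (congrArg (qNorm p) h1).trans_le h2

/-- Normalising `h` makes its scalar product with `Y` bounded, so `h` can be taken out of the
conditional expectation without integrability assumptions on `h`. -/
theorem dot_condExp_eq_of_dot_eq {Q : Measure Ω} [IsProbabilityMeasure Q] {m : MeasurableSpace Ω}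
    (hm : m ≤ mΩ) {p ε : ℝ} (hp : 0 < p) {h Y : Ω → Fin d → ℝ} (hY : Integrable Y Q)
    (hh : StronglyMeasurable[m] h) (hdot : ∀ᵐ ω ∂Q, dot (h ω) (Y ω) = ε * pNorm p (h ω)) :
    ∀ᵐ ω ∂Q, dot (h ω) ((Q[Y | m]) ω) = ε * pNorm p (h ω) := by
  have hN : Measurable[m] fun ω => pNorm p (h ω) := (measurable_pNorm p).comp hh.measurable
  set u : Ω → ℝ := fun ω => ε * ((pNorm p (h ω))⁻¹ * pNorm p (h ω)) with hu
  have hum : StronglyMeasurable[m] u := ((hN.inv.mul hN).const_mul ε).stronglyMeasurable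
  have hui : Integrable u Q := by
    refine Integrable.of_bound (hum.mono hm).aestronglyMeasurable |ε| (Eventually.of_forall ?_)
    intro ω
    by_cases h0 : pNorm p (h ω) = 0 <;> simp [hu, h0]
  have hg : StronglyMeasurable[m] fun ω => (pNorm p (h ω))⁻¹ • h ω :=
    hN.inv.stronglyMeasurable.smul hh
  have hgu : (fun ω => dotCLM d ((pNorm p (h ω))⁻¹ • h ω) (Y ω)) =ᵐ[Q] u := by
    filter_upwards [hdot] with ω hω
    rw [dotCLM_apply, dot_smul_left, hω, hu]
    ring
  have hpull := condExp_bilin_of_stronglyMeasurable_left (dotCLM d) hg (hui.congr hgu.symm) hY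
  have hcond := condExp_congr_ae (m := m) hgu
  rw [condExp_of_stronglyMeasurable hm hum hui] at hcond
  filter_upwards [hpull, hcond] with ω h1 h2
  rw [h1, dotCLM_apply, dot_smul_left] at h2
  by_cases h0 : pNorm p (h ω) = 0
  · have hzero : ∀ i, h ω i = 0 := fun i =>
      abs_eq_zero.1 (le_antisymm (h0 ▸ abs_le_pNorm hp (h ω) i) (abs_nonneg _))
    simp [dot, hzero, h0]
  · simp only [hu] at h2
    field_simp at h2
    linarith

theorem IsEpsMartMeasure.condExp_sub_mem_Fset {P Q : Measure Ω} {ℱ : Filtration ℕ mΩ}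
    {S : ℕ → Ω → Fin d → ℝ} {T : ℕ} {p ε : ℝ} (hQ : IsEpsMartMeasure P ℱ S T p ε Q)
    (hS : Adapted ℱ S) (hp : 1 ≤ p) (hε : 0 ≤ ε) {t : ℕ} (ht1 : 1 ≤ t) (htT : t ≤ T) :
    (Q[fun ω => S t ω - S (t - 1) ω | ℱ (t - 1)]) ∈ Fset P ℱ S p ε t := by
  have := hQ.1
  refine ⟨stronglyMeasurable_condExp, fun h hh => hQ.2.2.1.ae_le ?_⟩
  have hint : Integrable (fun ω => S t ω - S (t - 1) ω) Q :=
    (hQ.integrable hS hp hε htT).sub (hQ.integrable hS hp hε (by omega))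
  filter_upwards [hQ.qNorm_condExp_sub_le hS hp hε ht1 htT,
    dot_condExp_eq_of_dot_eq (ℱ.le _) (by linarith) hint hh.1 (hQ.2.1.ae_le hh.2)] with ω h1 h2
  refine le_antisymm (dot_le_qNorm_mul_pNorm hp _ _) ?_
  rw [dot_comm, h2]
  exact mul_le_mul_of_nonneg_right h1 (pNorm_nonneg p _)

/-- If `Q` is an `ε`-martingale measure and `t ∈ {1,…,T}`, then
`E_Q[ΔS_t | ℱ_{t-1}] ∈ F_{ε,t}` and `H_t · E_Q[ΔS_t | ℱ_{t-1}] = 0` `P`-a.s. for every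
`H_t ∈ F_{ε,t}^⊥`. -/
theorem eps_martingale_conditional_mean
    {Ω : Type*} [mΩ : MeasurableSpace Ω] {d T : ℕ}
    (P : Measure Ω) [IsProbabilityMeasure P] (ℱ : Filtration ℕ mΩ)
    (S : ℕ → Ω → Fin d → ℝ) (hS : Adapted ℱ S)
    (hd : 1 ≤ d) (hT : 1 ≤ T) (p ε : ℝ) (hp : 1 ≤ p) (hε : 0 < ε)
    (Q : Measure Ω) (hQ : IsEpsMartMeasure P ℱ S T p ε Q)
    (t : ℕ) (ht1 : 1 ≤ t) (htT : t ≤ T)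
    (Hb : ℕ → Ω → Fin d → ℝ)
    (hHb : ∀ s, 1 ≤ s → s ≤ T → IsMaximalEps P ℱ S p ε s (Hb s)) :
    (Q[fun ω => S t ω - S (t - 1) ω | ℱ (t - 1)]) ∈ Fset P ℱ S p ε t ∧
    ∀ h ∈ Fperp P ℱ S p ε t (Hb t),
      ∀ᵐ ω ∂P, dot (h ω) ((Q[fun ω' => S t ω' - S (t - 1) ω' | ℱ (t - 1)]) ω) = 0 := by
  have hX := hQ.condExp_sub_mem_Fset hS hp hε.le ht1 htT
  refine ⟨hX, fun h hh => ?_⟩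
  by_cases hp1 : p = 1
  · subst hp1
    rw [Fperp, if_pos rfl] at hh
    obtain ⟨-, hdual, hsupp⟩ := hh
    filter_upwards [hX.2 _ (hHb t ht1 htT).1, hdual, ae_all_iff.2 hsupp] with ω h1 h2 h3
    exact dot_eq_zero_of_dot_dualVec_eq_zero h1 h2 h3
  · rw [Fperp, if_neg hp1] at hh
    filter_upwards [hh.2 _ hX] with ω hω
    rwa [dot_comm]

end QFTAP
end
end
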